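/- Let 1 ≤ p < ∞ and let w be a doubling weight on ℝⁿ, i.e., there is a constant C₀ such that w(2B) ≤ C₀ w(B) for every ball B (where 2B is the concentric ball of twice the radius). If f ∈ RBV^p(ℝⁿ, w), then for all t > 0, w({x ∈ ℝⁿ : L_f(x) > t}) ≤ C (V_p(f; ℝⁿ, w)/t)^p, where L_f(x) = limsup_{y→x} |f(x) − f(y)|/|x − y|, and C depends only on p, n, and the doubling constant C₀. -/

import Mathlib

open MeasureTheory Metric Set ENNReal Filter

noncomputable section

/-- `n`-dimensional Euclidean space. -/
abbrev Eu (n : ℕ) := EuclideanSpace ℝ (Fin n)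

/-- The oscillation `osc_s(f) = sup_{x,y ∈ s} |f x - f y|`, valued in `ℝ≥0∞`. -/
noncomputable def oscOn {n : ℕ} (f : Eu n → ℝ) (s : Set (Eu n)) : ℝ≥0∞ :=
  ⨆ x ∈ s, ⨆ y ∈ s, ENNReal.ofReal |f x - f y|

/-- The measure `w(x) dx` associated to a weight `w`. -/
noncomputable def wMeasure (n : ℕ) (w : Eu n → ℝ) : Measure (Eu n) :=
  volume.withDensity fun x => ENNReal.ofReal (w x)

/-- A weight: a nonnegative locally integrable function. -/
def IsWeight (n : ℕ) (w : Eu n → ℝ) : Prop :=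
  (∀ x, 0 ≤ w x) ∧ LocallyIntegrable w volume

/-- A countable collection of pairwise disjoint open balls contained in `Ω`
(balls of radius `0` are empty and are allowed as padding, so that finite
collections are included). -/
structure BallPack (n : ℕ) (Ω : Set (Eu n)) where
  c : ℕ → Eu n
  r : ℕ → ℝ
  r_nonneg : ∀ k, 0 ≤ r k
  ball_subset : ∀ k, ball (c k) (r k) ⊆ Ω
  disj : Pairwise fun i j => Disjoint (ball (c i) (r i)) (ball (c j) (r j))

/-- The sum `Σ_k (osc_{B_k}(f)/r_k)^p w(B_k)` for a collection of disjoint balls. -/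
noncomputable def packSum {n : ℕ} {Ω : Set (Eu n)} (p : ℝ) (f w : Eu n → ℝ)
    (D : BallPack n Ω) : ℝ≥0∞ :=
  ∑' k, (oscOn f (ball (D.c k) (D.r k)) / ENNReal.ofReal (D.r k)) ^ p
      * wMeasure n w (ball (D.c k) (D.r k))

/-- The weighted Riesz `p`-variation `V_p(f; Ω, w)`. -/
noncomputable def rieszVar {n : ℕ} (p : ℝ) (f : Eu n → ℝ) (Ω : Set (Eu n))
    (w : Eu n → ℝ) : ℝ≥0∞ :=
  ⨆ D : BallPack n Ω, packSum p f w D ^ (1 / p)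

/-- `w` is a Muckenhoupt `A_p` weight with `A_p` constant at most `Cw`
(stated for both `p = 1` and `p > 1`; the first clause, positivity of `w` on balls,
rules out the degenerate weight vanishing on a ball). -/
def IsMuckenhoupt (n : ℕ) (p : ℝ) (w : Eu n → ℝ) (Cw : ℝ) : Prop :=
  (∀ (x : Eu n) (r : ℝ), 0 < r → 0 < ∫⁻ y in ball x r, ENNReal.ofReal (w y)) ∧
  (p = 1 → ∀ (x : Eu n) (r : ℝ), 0 < r →
      essSup (fun y => (ENNReal.ofReal (w y))⁻¹) (volume.restrict (ball x r)) *
        (⨍⁻ y in ball x r, ENNReal.ofReal (w y) ∂volume) ≤ ENNReal.ofReal Cw) ∧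
  (1 < p → ∀ (x : Eu n) (r : ℝ), 0 < r →
      (⨍⁻ y in ball x r, ENNReal.ofReal (w y) ∂volume) *
        (⨍⁻ y in ball x r, ENNReal.ofReal (w y) ^ (1 / (1 - p)) ∂volume) ^ (p - 1)
        ≤ ENNReal.ofReal Cw)

/-- `w ∈ A_p`. -/
def MemAp (n : ℕ) (p : ℝ) (w : Eu n → ℝ) : Prop :=
  ∃ Cw : ℝ, IsMuckenhoupt n p w Cw

/-- `r_w = inf { q > 1 : w ∈ A_q }`. -/
noncomputable def rwExp (n : ℕ) (w : Eu n → ℝ) : ℝ :=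
  sInf {q : ℝ | 1 < q ∧ MemAp n q w}

/-- `g` is the weak (distributional) `j`-th partial derivative of `f` on the open set `Ω`. -/
def HasWeakPartialDeriv (n : ℕ) (Ω : Set (Eu n)) (f g : Eu n → ℝ) (j : Fin n) : Prop :=
  ∀ φ : Eu n → ℝ, ContDiff ℝ (⊤ : ℕ∞) φ → HasCompactSupport φ → tsupport φ ⊆ Ω →
    ∫ x in Ω, f x * fderiv ℝ φ x (EuclideanSpace.single j 1) = - ∫ x in Ω, g x * φ x

/-- The local Lipschitz constant `L_f(x) = limsup_{y → x} |f x - f y| / |x - y|`. -/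
noncomputable def localLip {n : ℕ} (f : Eu n → ℝ) (x : Eu n) : ℝ≥0∞ :=
  Filter.limsup (fun y => ENNReal.ofReal (|f x - f y| / dist x y)) (nhdsWithin x {x}ᶜ)

/-- Convolution `(g ⋆ f)(x) = ∫ g(y) f(x - y) dy`. -/
noncomputable def convWith {n : ℕ} (g f : Eu n → ℝ) (x : Eu n) : ℝ :=
  ∫ y, g y * f (x - y)

/-- Variable exponent modular for `ℝ≥0∞`-valued functions: `∫_Ω f(x)^{p(x)} dx`. -/
noncomputable def varModularE {n : ℕ} (p : Eu n → ℝ) (Ω : Set (Eu n))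
    (f : Eu n → ℝ≥0∞) : ℝ≥0∞ :=
  ∫⁻ x in Ω, f x ^ p x

/-- Variable exponent Luxemburg norm for `ℝ≥0∞`-valued functions. -/
noncomputable def varLpNormE {n : ℕ} (p : Eu n → ℝ) (Ω : Set (Eu n))
    (f : Eu n → ℝ≥0∞) : ℝ≥0∞ :=
  sInf (ENNReal.ofReal ''
    {lam : ℝ | 0 < lam ∧ varModularE p Ω (fun x => f x / ENNReal.ofReal lam) ≤ 1})

/-- Variable exponent Luxemburg norm `‖f‖_{L^{p(·)}(Ω)}`. -/
noncomputable def varLpNorm {n : ℕ} (p : Eu n → ℝ) (Ω : Set (Eu n)) (f : Eu n → ℝ) : ℝ≥0∞ :=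
  varLpNormE p Ω fun x => ENNReal.ofReal |f x|

/-- `p(·)` is log-Hölder continuous on `Ω`, locally and at infinity. -/
def LogHolder {n : ℕ} (p : Eu n → ℝ) (Ω : Set (Eu n)) : Prop :=
  (∃ C₀ > (0:ℝ), ∀ x ∈ Ω, ∀ y ∈ Ω, dist x y < 1/2 →
      |p x - p y| ≤ C₀ / (-Real.log (dist x y))) ∧
  (∃ pinf : ℝ, ∃ Cinf > (0:ℝ), ∀ x ∈ Ω,
      |p x - pinf| ≤ Cinf / Real.log (Real.exp 1 + ‖x‖))

/-- The harmonic mean `p_B` of the exponent `p(·)` on a set `B`: `1/p_B = ⨍_B 1/p(x) dx`. -/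
noncomputable def harmMean {n : ℕ} (p : Eu n → ℝ) (B : Set (Eu n)) : ℝ :=
  (⨍ x in B, (p x)⁻¹)⁻¹

/-- The variable exponent Riesz modular
`V_𝒟^{p(·)}(f;Ω) = Σ_k (osc_{B_k}(f)/r_k)^{p_{B_k}} ‖χ_{B_k}‖_{p(·)}^{p_{B_k}}`. -/
noncomputable def varRieszModular {n : ℕ} (p : Eu n → ℝ) (Ω : Set (Eu n))
    (D : BallPack n Ω) (f : Eu n → ℝ) : ℝ≥0∞ :=
  ∑' k, (oscOn f (ball (D.c k) (D.r k)) / ENNReal.ofReal (D.r k))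
          ^ harmMean p (ball (D.c k) (D.r k))
      * varLpNorm p Ω ((ball (D.c k) (D.r k)).indicator fun _ => (1:ℝ))
          ^ harmMean p (ball (D.c k) (D.r k))

/-- The Luxemburg-type norm `‖f‖_{RBV_𝒟^{p(·)}(Ω)}`. -/
noncomputable def varRBVDNorm {n : ℕ} (p : Eu n → ℝ) (Ω : Set (Eu n))
    (D : BallPack n Ω) (f : Eu n → ℝ) : ℝ≥0∞ :=
  sInf (ENNReal.ofReal ''
    {lam : ℝ | 0 < lam ∧ varRieszModular p Ω D (fun x => f x / lam) ≤ 1})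

/-- `‖f‖_{RBV^{p(·)}(Ω)} = sup_𝒟 ‖f‖_{RBV_𝒟^{p(·)}(Ω)}`. -/
noncomputable def varRBVNorm {n : ℕ} (p : Eu n → ℝ) (Ω : Set (Eu n)) (f : Eu n → ℝ) : ℝ≥0∞ :=
  ⨆ D : BallPack n Ω, varRBVDNorm p Ω D f

/-- The operator `G_𝒟 f = Σ_k (osc_{B_k}(f)/r_k) χ_{B_k}`. -/
noncomputable def GD {n : ℕ} {Ω : Set (Eu n)} (f : Eu n → ℝ) (D : BallPack n Ω)
    (x : Eu n) : ℝ≥0∞ :=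
  ∑' k, (ball (D.c k) (D.r k)).indicator
      (fun _ => oscOn f (ball (D.c k) (D.r k)) / ENNReal.ofReal (D.r k)) x

end

/-- A countable family of pairwise disjoint balls bounds a partial sum of the `p`-variation. -/
theorem tsum_le_rieszVar_rpow {n : ℕ} {p : ℝ} (hp : 0 < p) (f w : Eu n → ℝ) {u : Set (Eu n)}
    (hu : u.Countable) (r : Eu n → ℝ) (hr : ∀ x ∈ u, 0 ≤ r x)
    (hd : u.PairwiseDisjoint fun x => ball x (r x)) :
    ∑' x : u, (oscOn f (ball (x : Eu n) (r x)) / ENNReal.ofReal (r x)) ^ p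
      * wMeasure n w (ball (x : Eu n) (r x)) ≤ rieszVar p f Set.univ w ^ p := by
  have : Countable u := hu.to_subtype
  obtain ⟨g, hg⟩ := exists_injective_nat u
  have key : ∀ k, (∃ x : u, g x = k) ∨
      Function.extend g (fun x : u => r x) (fun _ => 0) k = 0 := by
    intro k
    by_cases h : ∃ x : u, g x = k
    · exact Or.inl h
    · exact Or.inr (Function.extend_apply' _ _ _ h)
  let D : BallPack n Set.univ :=
    { c := Function.extend g (fun x : u => (x : Eu n)) (fun _ => 0)
      r := Function.extend g (fun x : u => r x) (fun _ => 0)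
      r_nonneg := by
        intro k
        rcases key k with ⟨x, rfl⟩ | h
        · rw [hg.extend_apply]
          exact hr x x.2
        · exact h.ge
      ball_subset := fun k => Set.subset_univ _
      disj := by
        intro i j hij
        rcases key i with ⟨x, rfl⟩ | h
        · rcases key j with ⟨y, rfl⟩ | h'
          · simp only [hg.extend_apply]
            refine hd x.2 y.2 fun h => hij ?_
            rw [Subtype.ext h]
          · simp [h']
        · simp [h] }
  have h1 : ∑' x : u, (oscOn f (ball (x : Eu n) (r x)) / ENNReal.ofReal (r x)) ^ p
      * wMeasure n w (ball (x : Eu n) (r x)) ≤ packSum p f w D := by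
    have h := ENNReal.tsum_comp_le_tsum_of_injective hg
      (fun k => (oscOn f (ball (D.c k) (D.r k)) / ENNReal.ofReal (D.r k)) ^ p
        * wMeasure n w (ball (D.c k) (D.r k)))
    simpa only [packSum, D, hg.extend_apply] using h
  have h2 : packSum p f w D ^ (1 / p) ≤ rieszVar p f Set.univ w :=
    le_iSup (fun D : BallPack n Set.univ => packSum p f w D ^ (1 / p)) D
  rw [one_div] at h2
  exact h1.trans ((ENNReal.rpow_inv_le_iff hp).1 h2)

/-- Near a point where the local Lipschitz constant exceeds `t` there is a ball of radius at
most one on which the oscillation is at least `t / 2` times the radius. -/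
theorem exists_le_oscOn_div_of_lt_localLip {n : ℕ} {f : Eu n → ℝ} {x : Eu n} {t : ℝ}
    (h : ENNReal.ofReal t < localLip f x) :
    ∃ r : ℝ, 0 < r ∧ r ≤ 1 ∧
      ENNReal.ofReal (t / 2) ≤ oscOn f (ball x r) / ENNReal.ofReal r := by
  have hf := Filter.frequently_lt_of_lt_limsup (by isBoundedDefault) h
  have he : ∀ᶠ y in nhdsWithin x {x}ᶜ, y ∈ ball x (1 / 2) :=
    nhdsWithin_le_nhds (ball_mem_nhds x (by norm_num))
  obtain ⟨y, hty, hy, hyx⟩ := (hf.and_eventually (he.and self_mem_nhdsWithin)).exists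
  have hpos : 0 < dist x y := dist_pos.2 fun h => hyx h.symm
  have hlt : dist x y < 1 / 2 := by rwa [dist_comm]
  refine ⟨2 * dist x y, by positivity, by linarith, ?_⟩
  have hosc : ENNReal.ofReal |f x - f y| ≤ oscOn f (ball x (2 * dist x y)) := by
    have hx : x ∈ ball x (2 * dist x y) := mem_ball_self (by positivity)
    have hy' : y ∈ ball x (2 * dist x y) := by
      rw [mem_ball, dist_comm]
      linarith
    exact le_iSup₂_of_le x hx (le_iSup₂_of_le y hy' le_rfl)
  have hpos' : (0 : ℝ) < 2 * dist x y := by positivity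
  calc ENNReal.ofReal (t / 2) ≤ ENNReal.ofReal (|f x - f y| / (2 * dist x y)) := by
        apply ENNReal.ofReal_le_ofReal
        have h1 := ((ENNReal.ofReal_lt_ofReal_iff').1 hty).1.le
        rw [mul_comm, ← div_div]
        linarith
    _ = ENNReal.ofReal |f x - f y| / ENNReal.ofReal (2 * dist x y) :=
        ENNReal.ofReal_div_of_pos hpos'
    _ ≤ _ := ENNReal.div_le_div_right hosc _

/-- The weak type estimate for the local Lipschitz constant holds for any
doubling weight: if `w(2B) ≤ C₀ w(B)` for all balls `B` and `f ∈ RBV^p(ℝⁿ,w)`, then for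
all `t > 0`, `w({L_f > t}) ≤ C (V_p(f; ℝⁿ, w)/t)^p`, with `C = C(n, p, C₀)`. -/
theorem statement6 (n : ℕ) (hn : 0 < n) (p C₀ : ℝ) (hp : 1 ≤ p) :
    ∃ C : ℝ, 0 < C ∧
      ∀ w : Eu n → ℝ, IsWeight n w →
        (∀ (x : Eu n) (r : ℝ), 0 < r →
          wMeasure n w (ball x (2 * r)) ≤ ENNReal.ofReal C₀ * wMeasure n w (ball x r)) →
      ∀ f : Eu n → ℝ, rieszVar p f Set.univ w < ⊤ →
      ∀ t : ℝ, 0 < t →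
        wMeasure n w {x | ENNReal.ofReal t < localLip f x} ≤
          ENNReal.ofReal C * (rieszVar p f Set.univ w / ENNReal.ofReal t) ^ p := by
  refine ⟨(max C₀ 1) ^ 3 * 2 ^ p, by positivity, ?_⟩
  intro w _ hdbl f _ t ht
  have hp0 : 0 < p := by linarith
  set E := {x | ENNReal.ofReal t < localLip f x} with hE
  set K := ENNReal.ofReal (max C₀ 1) with hK
  set V := rieszVar p f Set.univ w
  have hex : ∀ x : Eu n, ∃ r : ℝ, x ∈ E → 0 < r ∧ r ≤ 1 ∧
      ENNReal.ofReal (t / 2) ≤ oscOn f (ball x r) / ENNReal.ofReal r := by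
    intro x
    by_cases hx : x ∈ E
    · obtain ⟨r, hr⟩ := exists_le_oscOn_div_of_lt_localLip hx
      exact ⟨r, fun _ => hr⟩
    · exact ⟨0, fun h => absurd h hx⟩
  choose r hr using hex
  obtain ⟨u, huE, hud, hcov⟩ := Vitali.exists_disjoint_subfamily_covering_enlargement_closedBall
    E (fun x => x) r 1 (fun x hx => (hr x hx).2.1) 5 (by norm_num)
  have hud' : u.PairwiseDisjoint fun x => ball x (r x) :=
    hud.mono_on fun x _ => ball_subset_closedBall
  have hucount : u.Countable :=
    hud'.countable_of_isOpen (fun x _ => isOpen_ball)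
      fun x hx => nonempty_ball.2 (hr x (huE hx)).1
  have hstep : ∀ (x : Eu n) (s : ℝ), 0 < s →
      wMeasure n w (ball x (2 * s)) ≤ K * wMeasure n w (ball x s) := fun x s hs =>
    (hdbl x s hs).trans (by gcongr; exact ENNReal.ofReal_le_ofReal (le_max_left _ _))
  have height : ∀ x ∈ u, wMeasure n w (closedBall x (5 * r x)) ≤
      K ^ 3 * wMeasure n w (ball x (r x)) := by
    intro x hx
    have hrx := (hr x (huE hx)).1
    calc wMeasure n w (closedBall x (5 * r x))
        ≤ wMeasure n w (ball x (2 * (2 * (2 * r x)))) :=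
          measure_mono (closedBall_subset_ball (by linarith))
      _ ≤ K * (K * (K * wMeasure n w (ball x (r x)))) := by
          refine (hstep x _ (by positivity)).trans ?_
          gcongr
          refine (hstep x _ (by positivity)).trans ?_
          gcongr
          exact hstep x _ hrx
      _ = _ := by ring
  have hsub : E ⊆ ⋃ x ∈ u, closedBall x (5 * r x) := by
    intro x hx
    obtain ⟨b, hb, hxb⟩ := hcov x hx
    exact mem_biUnion hb (hxb (mem_closedBall_self (hr x hx).1.le))
  have ht2 : ENNReal.ofReal (t / 2) ^ p ≠ 0 := by
    simp [ENNReal.rpow_eq_zero_iff, ht, hp0.not_gt]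
  have ht2' : ENNReal.ofReal (t / 2) ^ p ≠ ⊤ :=
    ENNReal.rpow_ne_top_of_nonneg hp0.le ENNReal.ofReal_ne_top
  have hsum : ENNReal.ofReal (t / 2) ^ p * ∑' x : u, wMeasure n w (ball (x : Eu n) (r x)) ≤
      V ^ p := by
    rw [← ENNReal.tsum_mul_left]
    refine le_trans (ENNReal.tsum_le_tsum fun x => ?_)
      (tsum_le_rieszVar_rpow hp0 f w hucount r (fun x hx => (hr x (huE hx)).1.le) hud')
    gcongr
    exact (hr x (huE x.2)).2.2
  have hconst : ENNReal.ofReal (max C₀ 1 ^ 3 * 2 ^ p) * (V / ENNReal.ofReal t) ^ p =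
      K ^ 3 * (V ^ p / ENNReal.ofReal (t / 2) ^ p) := by
    rw [ENNReal.ofReal_mul (by positivity), ENNReal.ofReal_pow (by positivity), mul_assoc,
      ← ENNReal.ofReal_rpow_of_pos two_pos, ← ENNReal.mul_rpow_of_nonneg _ _ hp0.le,
      ← ENNReal.div_rpow_of_nonneg _ _ hp0.le, ENNReal.ofReal_div_of_pos two_pos]
    congr 2
    rw [ENNReal.div_eq_inv_mul, ENNReal.div_eq_inv_mul, ENNReal.inv_div (by simp) (by simp),
      ENNReal.div_eq_inv_mul]
    ring
  calc wMeasure n w E ≤ wMeasure n w (⋃ x ∈ u, closedBall x (5 * r x)) := measure_mono hsub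
    _ ≤ ∑' x : u, wMeasure n w (closedBall (x : Eu n) (5 * r x)) :=
        measure_biUnion_le _ hucount _
    _ ≤ ∑' x : u, K ^ 3 * wMeasure n w (ball (x : Eu n) (r x)) :=
        ENNReal.tsum_le_tsum fun x => height x x.2
    _ = K ^ 3 * ∑' x : u, wMeasure n w (ball (x : Eu n) (r x)) := ENNReal.tsum_mul_left
    _ ≤ K ^ 3 * (V ^ p / ENNReal.ofReal (t / 2) ^ p) := by
        gcongr
        rw [ENNReal.le_div_iff_mul_le (Or.inl ht2) (Or.inl ht2'), mul_comm]
        exact hsum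
    _ = _ := hconst.symm
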